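/- Let 𝔐 be the set of two-sided ad_T-invariant ideals of T(𝔞) containing ker τ[t], and let 𝓜 be the set of isomorphism classes of 𝔞[t]-modules. Then: (a) the map 𝔐 → 𝓜 sending 𝕀 to the isomorphism class of the 𝔞[t]-module V(ρ_𝕀, η_𝕀) = T(𝔞)/𝕀 is injective; (b) the map 𝓜 → 𝔐 sending the class of V(ρ,η) to 𝕀(ρ,η) = ker η_T is surjective. -/

import Mathlib

open TensorAlgebra TensorProduct Polynomial

noncomputable section

/-- The graded pieces `F^r(a)` of the free Lie algebra on the vector space `a`,
realized inside the tensor algebra `T(a)`:  `F¹(a) = ι(a)` and `F^{r+1}(a)` is spanned by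
the commutators `ι(x) * y - y * ι(x)` with `x ∈ a`, `y ∈ F^r(a)`. -/
def Fr (a : Type*) [LieRing a] [LieAlgebra ℂ a] : ℕ → Submodule ℂ (TensorAlgebra ℂ a)
  | 0 => ⊥
  | 1 => LinearMap.range (TensorAlgebra.ι ℂ (M := a))
  | (r + 2) => Submodule.span ℂ
      {u | ∃ (x : a) (y : TensorAlgebra ℂ a), y ∈ Fr a (r + 1) ∧
        u = TensorAlgebra.ι ℂ x * y - y * TensorAlgebra.ι ℂ x}

/-- The free Lie algebra `F(a) = ⊕_{r>0} F^r(a)` on the vector space `a`,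
as a subspace of the tensor algebra. -/
def FLie (a : Type*) [LieRing a] [LieAlgebra ℂ a] : Submodule ℂ (TensorAlgebra ℂ a) :=
  ⨆ r, Fr a r

/-- `IsTau a τ` says that the linear map `τ` is (a linear extension to `T(a)` of) the canonical
Lie algebra homomorphism `τ : F(a) → a`: it is the identity on `F¹(a) = a` and takes the
commutator bracket of `T(a)` (restricted to `F(a)`) to the bracket of `a`. -/
def IsTau (a : Type*) [LieRing a] [LieAlgebra ℂ a] (τ : TensorAlgebra ℂ a →ₗ[ℂ] a) : Prop :=
  (∀ x : a, τ (TensorAlgebra.ι ℂ x) = x) ∧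
  ∀ r s : ℕ, ∀ u ∈ Fr a r, ∀ v ∈ Fr a s, τ (u * v - v * u) = ⁅τ u, τ v⁆

/-- The current algebra `a[t] = a ⊗ ℂ[t]`, with bracket `⁅x ⊗ f, y ⊗ g⁆ = ⁅x, y⁆ ⊗ fg`. -/
abbrev Cur (a : Type*) [LieRing a] [LieAlgebra ℂ a] : Type _ := Polynomial ℂ ⊗[ℂ] a

/-- `IsTauT a τ τt` says that the linear map `τt` is (a linear extension to `T(a)` of) the map
`τ[t] : F(a) → a[t]` given by `τ[t](𝐱) = τ(𝐱) ⊗ t^r` for `𝐱 ∈ F^r(a)`. -/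
def IsTauT (a : Type*) [LieRing a] [LieAlgebra ℂ a] (τ : TensorAlgebra ℂ a →ₗ[ℂ] a)
    (τt : TensorAlgebra ℂ a →ₗ[ℂ] Cur a) : Prop :=
  ∀ r : ℕ, ∀ u ∈ Fr a r, τt u = ((X : ℂ[X]) ^ r) ⊗ₜ[ℂ] (τ u)

end

noncomputable section

/-- `IsAdT a adT` says that `adT` is the diagonal adjoint action of `a` on its tensor algebra,
i.e. `adT x` is the derivation of `T(a)` with `adT x (ι y) = ι ⁅x, y⁆`. -/
def IsAdT (a : Type*) [LieRing a] [LieAlgebra ℂ a]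
    (adT : a →ₗ[ℂ] Module.End ℂ (TensorAlgebra ℂ a)) : Prop :=
  (∀ x : a, adT x 1 = 0) ∧
  (∀ x y : a, adT x (TensorAlgebra.ι ℂ y) = TensorAlgebra.ι ℂ ⁅x, y⁆) ∧
  (∀ (x : a) (u v : TensorAlgebra ℂ a), adT x (u * v) = adT x u * v + u * adT x v)

/-- The bracket of the semidirect product `𝔉 = a ⊕ F(a)`, written on the ambient space
`a × T(a)`:  `⁅(x, 𝐲), (x', 𝐲')⁆ = (⁅x,x'⁆, adT x 𝐲' - adT x' 𝐲 + (𝐲𝐲' - 𝐲'𝐲))`. -/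
def Fbr (a : Type*) [LieRing a] [LieAlgebra ℂ a]
    (adT : a →ₗ[ℂ] Module.End ℂ (TensorAlgebra ℂ a))
    (p q : a × TensorAlgebra ℂ a) : a × TensorAlgebra ℂ a :=
  (⁅p.1, q.1⁆, adT p.1 q.2 - adT q.1 p.2 + (p.2 * q.2 - q.2 * p.2))

/-- The extension of `τ[t]` to `𝔉 = a ⊕ F(a)`, sending `(x, 𝐲)` to `x ⊗ 1 + τ[t](𝐲)`. -/
def PhiF (a : Type*) [LieRing a] [LieAlgebra ℂ a]
    (τt : TensorAlgebra ℂ a →ₗ[ℂ] Cur a) (p : a × TensorAlgebra ℂ a) : Cur a :=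
  (1 : ℂ[X]) ⊗ₜ[ℂ] p.1 + τt p.2

end

noncomputable section

/-- `MemH a V τ ρ η`, i.e. `(ρ, η) ∈ ℋ(V)`:  `ρ` is a Lie algebra homomorphism (C1), `η` is a
homomorphism of `a`-modules for the `a`-module structure on `End V` induced by `ρ` (C2), and
`ker τ_r ⊆ ker η^{⊙r}` for all `r > 0` (C3), where `η^{⊙r}` is the restriction to
`F^r(a) ⊆ T^r(a)` of the algebra homomorphism `η_T : T(a) → End V` extending `η`. -/
def MemH (a : Type*) [LieRing a] [LieAlgebra ℂ a] {V : Type*} [AddCommGroup V] [Module ℂ V]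
    (τ : TensorAlgebra ℂ a →ₗ[ℂ] a) (ρ η : a →ₗ[ℂ] Module.End ℂ V) : Prop :=
  (∀ x y : a, ρ ⁅x, y⁆ = ⁅ρ x, ρ y⁆) ∧
  (∀ x y : a, η ⁅x, y⁆ = ⁅ρ x, η y⁆) ∧
  (∀ r : ℕ, ∀ u ∈ Fr a r, τ u = 0 → TensorAlgebra.lift ℂ η u = 0)

/-- `IsCurHom a ρ₁ η₁ ρ₂ η₂ φ` says that the linear map `φ : V₁ → V₂` is a homomorphism of
`a[t]`-modules from `V₁(ρ₁, η₁)` to `V₂(ρ₂, η₂)`: it intertwines the actions of `x ⊗ 1`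
(given by `ρᵢ`) and of `x ⊗ t^r` (given by `ηᵢ^{⊙r}(𝐱)` for `𝐱 ∈ F^r(a)` with `τ_r(𝐱) = x`). -/
def IsCurHom (a : Type*) [LieRing a] [LieAlgebra ℂ a]
    {V1 V2 : Type*} [AddCommGroup V1] [Module ℂ V1] [AddCommGroup V2] [Module ℂ V2]
    (ρ1 η1 : a →ₗ[ℂ] Module.End ℂ V1) (ρ2 η2 : a →ₗ[ℂ] Module.End ℂ V2)
    (φ : V1 →ₗ[ℂ] V2) : Prop :=
  (∀ x : a, φ ∘ₗ ρ1 x = ρ2 x ∘ₗ φ) ∧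
  ∀ r : ℕ, ∀ u ∈ Fr a r,
    φ ∘ₗ (TensorAlgebra.lift ℂ η1 u : Module.End ℂ V1)
      = (TensorAlgebra.lift ℂ η2 u : Module.End ℂ V2) ∘ₗ φ

end

universe u

section

variable {a : Type*} [LieRing a] [LieAlgebra ℂ a]

/-- A linear map that turns left multiplication by generators into `η` intertwines left
multiplication by `w` with `lift η w`. -/
theorem lift_apply_map_eq_map_mul {V : Type*} [AddCommGroup V] [Module ℂ V]
    {η : a →ₗ[ℂ] Module.End ℂ V} {π : TensorAlgebra ℂ a →ₗ[ℂ] V}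
    (h : ∀ x u, η x (π u) = π (TensorAlgebra.ι ℂ x * u)) (w u : TensorAlgebra ℂ a) :
    (TensorAlgebra.lift ℂ η w : Module.End ℂ V) (π u) = π (w * u) := by
  induction w using TensorAlgebra.induction generalizing u with
  | algebraMap r => simp [Algebra.algebraMap_eq_smul_one]
  | ι x => simpa using h x u
  | mul w₁ w₂ h₁ h₂ => simp [h₁, h₂, mul_assoc]
  | add w₁ w₂ h₁ h₂ => simp [h₁, h₂, add_mul]

/-- The kernel of the algebra map `T(a) → End (T(a) ⧸ I)` given by left multiplication is the
two-sided ideal `I`. -/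
theorem lift_eq_zero_iff_mem {I : Submodule ℂ (TensorAlgebra ℂ a)}
    (hI : ∀ w : TensorAlgebra ℂ a, ∀ u ∈ I, u * w ∈ I)
    {η : a →ₗ[ℂ] Module.End ℂ (TensorAlgebra ℂ a ⧸ I)}
    (h : ∀ (x : a) (u : TensorAlgebra ℂ a),
      η x (Submodule.Quotient.mk u) = Submodule.Quotient.mk (TensorAlgebra.ι ℂ x * u))
    (w : TensorAlgebra ℂ a) :
    (TensorAlgebra.lift ℂ η w : Module.End ℂ (TensorAlgebra ℂ a ⧸ I)) = 0 ↔ w ∈ I := by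
  have key := lift_apply_map_eq_map_mul (π := I.mkQ) h w
  constructor
  · intro hw
    have h1 := key 1
    rw [hw, mul_one, LinearMap.zero_apply, Submodule.mkQ_apply] at h1
    exact (Submodule.Quotient.mk_eq_zero I).1 h1.symm
  · intro hw
    refine LinearMap.ext fun v => ?_
    obtain ⟨u, rfl⟩ := I.mkQ_surjective v
    rw [key, LinearMap.zero_apply, Submodule.mkQ_apply]
    exact (Submodule.Quotient.mk_eq_zero I).2 (hI u w hw)

/-- A linear map intertwining two families of endomorphisms intertwines their extensions to the
tensor algebra. -/
theorem map_lift_apply {V₁ V₂ : Type*} [AddCommGroup V₁] [Module ℂ V₁] [AddCommGroup V₂]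
    [Module ℂ V₂] {η₁ : a →ₗ[ℂ] Module.End ℂ V₁} {η₂ : a →ₗ[ℂ] Module.End ℂ V₂}
    {φ : V₁ →ₗ[ℂ] V₂} (h : ∀ x v, φ (η₁ x v) = η₂ x (φ v)) (w : TensorAlgebra ℂ a) (v : V₁) :
    φ ((TensorAlgebra.lift ℂ η₁ w : Module.End ℂ V₁) v)
      = (TensorAlgebra.lift ℂ η₂ w : Module.End ℂ V₂) (φ v) := by
  induction w using TensorAlgebra.induction generalizing v with
  | algebraMap r => simp [Algebra.algebraMap_eq_smul_one]
  | ι x => simpa using h x v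
  | mul w₁ w₂ h₁ h₂ => simp [h₁, h₂]
  | add w₁ w₂ h₁ h₂ => simp [h₁, h₂]

theorem IsCurHom.lift_eq_zero_iff {V₁ V₂ : Type*} [AddCommGroup V₁] [Module ℂ V₁]
    [AddCommGroup V₂] [Module ℂ V₂] {ρ₁ η₁ : a →ₗ[ℂ] Module.End ℂ V₁}
    {ρ₂ η₂ : a →ₗ[ℂ] Module.End ℂ V₂} {φ : V₁ ≃ₗ[ℂ] V₂}
    (hφ : IsCurHom a ρ₁ η₁ ρ₂ η₂ φ.toLinearMap) (w : TensorAlgebra ℂ a) :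
    (TensorAlgebra.lift ℂ η₁ w : Module.End ℂ V₁) = 0 ↔
      (TensorAlgebra.lift ℂ η₂ w : Module.End ℂ V₂) = 0 := by
  have h : ∀ x v, φ.toLinearMap (η₁ x v) = η₂ x (φ.toLinearMap v) := fun x v => by
    have := LinearMap.congr_fun (hφ.2 1 (TensorAlgebra.ι ℂ x) ⟨x, rfl⟩) v
    simpa using this
  have key := map_lift_apply h w
  constructor
  · intro hw
    refine LinearMap.ext fun v => ?_
    obtain ⟨v, rfl⟩ := φ.surjective v
    simpa [hw] using (key v).symm
  · intro hw
    refine LinearMap.ext fun v => φ.injective ?_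
    simpa [hw] using key v

theorem IsAdT.map_algebraMap {adT : a →ₗ[ℂ] Module.End ℂ (TensorAlgebra ℂ a)}
    (hadT : IsAdT a adT) (x : a) (r : ℂ) :
    adT x (algebraMap ℂ (TensorAlgebra ℂ a) r) = 0 := by
  rw [Algebra.algebraMap_eq_smul_one, map_smul, hadT.1, smul_zero]

theorem IsAdT.map_lie_apply {adT : a →ₗ[ℂ] Module.End ℂ (TensorAlgebra ℂ a)}
    (hadT : IsAdT a adT) (x y : a) (u : TensorAlgebra ℂ a) :
    adT ⁅x, y⁆ u = adT x (adT y u) - adT y (adT x u) := by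
  induction u using TensorAlgebra.induction with
  | algebraMap r => simp [hadT.map_algebraMap]
  | ι z => simp only [hadT.2.1, lie_lie, map_sub]
  | mul u v hu hv =>
    simp only [hadT.2.2, map_add, hu, hv]
    noncomm_ring
  | add u v hu hv =>
    simp only [map_add, hu, hv]
    abel

theorem lift_adT_apply {adT : a →ₗ[ℂ] Module.End ℂ (TensorAlgebra ℂ a)} (hadT : IsAdT a adT)
    {V : Type*} [AddCommGroup V] [Module ℂ V] {ρ η : a →ₗ[ℂ] Module.End ℂ V}
    (h : ∀ x y : a, η ⁅x, y⁆ = ⁅ρ x, η y⁆) (x : a) (u : TensorAlgebra ℂ a) :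
    (TensorAlgebra.lift ℂ η (adT x u) : Module.End ℂ V) = ⁅ρ x, TensorAlgebra.lift ℂ η u⁆ := by
  induction u using TensorAlgebra.induction with
  | algebraMap r =>
    rw [hadT.map_algebraMap, map_zero, AlgHom.commutes, Ring.lie_def, Algebra.commutes, sub_self]
  | ι z => rw [hadT.2.1, TensorAlgebra.lift_ι_apply, TensorAlgebra.lift_ι_apply, h]
  | mul u v hu hv =>
    rw [hadT.2.2, map_add, map_mul, map_mul, map_mul, hu, hv]
    simp only [Ring.lie_def]
    noncomm_ring
  | add u v hu hv =>
    rw [map_add, map_add, map_add, hu, hv]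
    simp only [Ring.lie_def]
    noncomm_ring

/-- An element of the free Lie algebra killed by `τ[t]` has all its graded components killed
by `τ`. -/
theorem exists_sum_of_mem_FLie {τ : TensorAlgebra ℂ a →ₗ[ℂ] a}
    {τt : TensorAlgebra ℂ a →ₗ[ℂ] Cur a} (hτt : IsTauT a τ τt) {u : TensorAlgebra ℂ a}
    (hu : u ∈ FLie a) (h0 : τt u = 0) :
    ∃ f : ℕ →₀ TensorAlgebra ℂ a,
      (∀ r, f r ∈ Fr a r ∧ τ (f r) = 0) ∧ (f.sum fun _ v => v) = u := by
  obtain ⟨f, hf, rfl⟩ := (Submodule.mem_iSup_iff_exists_finsupp _ _).1 hu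
  refine ⟨f, fun r => ⟨hf r, ?_⟩, rfl⟩
  let c : Cur a →ₗ[ℂ] a :=
    (TensorProduct.lid ℂ a).toLinearMap ∘ₗ (Polynomial.lcoeff ℂ r).rTensor a
  have hc : ∀ i, c (τt (f i)) = if r = i then τ (f i) else 0 := fun i => by
    simp [c, hτt i (f i) (hf i), Polynomial.coeff_X_pow, ite_smul]
  have h := congrArg c h0
  rw [Finsupp.sum, map_sum, map_sum, map_zero] at h
  simp only [hc] at h
  rw [Finset.sum_ite_eq] at h
  by_cases hr : r ∈ f.support
  · rwa [if_pos hr] at h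
  · rw [Finsupp.notMem_support_iff.1 hr, map_zero]

theorem MemH.lift_eq_zero_of_mem_FLie {τ : TensorAlgebra ℂ a →ₗ[ℂ] a}
    {τt : TensorAlgebra ℂ a →ₗ[ℂ] Cur a} (hτt : IsTauT a τ τt)
    {V : Type*} [AddCommGroup V] [Module ℂ V] {ρ η : a →ₗ[ℂ] Module.End ℂ V}
    (h : MemH a τ ρ η) {u : TensorAlgebra ℂ a} (hu : u ∈ FLie a) (h0 : τt u = 0) :
    (TensorAlgebra.lift ℂ η u : Module.End ℂ V) = 0 := by
  obtain ⟨f, hf, rfl⟩ := exists_sum_of_mem_FLie hτt hu h0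
  rw [Finsupp.sum, map_sum]
  exact Finset.sum_eq_zero fun r _ => h.2.2 r (f r) (hf r).1 (hf r).2

/-- The pair `(ρ_I, η_I)` on the quotient `T(a) ⧸ I` lies in `ℋ(T(a) ⧸ I)`. -/
theorem exists_memH_quotient {τ : TensorAlgebra ℂ a →ₗ[ℂ] a}
    {τt : TensorAlgebra ℂ a →ₗ[ℂ] Cur a} (hτt : IsTauT a τ τt)
    {adT : a →ₗ[ℂ] Module.End ℂ (TensorAlgebra ℂ a)} (hadT : IsAdT a adT)
    {I : Submodule ℂ (TensorAlgebra ℂ a)}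
    (hl : ∀ w : TensorAlgebra ℂ a, ∀ u ∈ I, w * u ∈ I)
    (hr : ∀ w : TensorAlgebra ℂ a, ∀ u ∈ I, u * w ∈ I)
    (had : ∀ x : a, ∀ u ∈ I, adT x u ∈ I)
    (hker : ∀ u ∈ FLie a, τt u = 0 → u ∈ I) :
    ∃ ρ η : a →ₗ[ℂ] Module.End ℂ (TensorAlgebra ℂ a ⧸ I), MemH a τ ρ η ∧
      ∀ (x : a) (u : TensorAlgebra ℂ a),
        η x (Submodule.Quotient.mk u) = Submodule.Quotient.mk (TensorAlgebra.ι ℂ x * u) := by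
  let ρ : a →ₗ[ℂ] Module.End ℂ (TensorAlgebra ℂ a ⧸ I) :=
    { toFun := fun x => I.mapQ I (adT x) (had x)
      map_add' := fun x y => I.linearMap_qext (LinearMap.ext fun u => by simp)
      map_smul' := fun c x => I.linearMap_qext (LinearMap.ext fun u => by simp) }
  let η : a →ₗ[ℂ] Module.End ℂ (TensorAlgebra ℂ a ⧸ I) :=
    { toFun := fun x => I.mapQ I (LinearMap.mulLeft ℂ (TensorAlgebra.ι ℂ x)) (hl _)
      map_add' := fun x y => I.linearMap_qext (LinearMap.ext fun u => congrArg I.mkQ (by simp [add_mul]))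
      map_smul' := fun c x => I.linearMap_qext (LinearMap.ext fun u => congrArg I.mkQ (by simp)) }
  have hρ : ∀ (x : a) (u : TensorAlgebra ℂ a),
      ρ x (Submodule.Quotient.mk u) = Submodule.Quotient.mk (adT x u) := fun _ _ => rfl
  have hη : ∀ (x : a) (u : TensorAlgebra ℂ a),
      η x (Submodule.Quotient.mk u) = Submodule.Quotient.mk (TensorAlgebra.ι ℂ x * u) :=
    fun _ _ => rfl
  refine ⟨ρ, η, ⟨fun x y => ?_, fun x y => ?_, fun r u hu h0 => ?_⟩, hη⟩
  · refine I.linearMap_qext (LinearMap.ext fun u => ?_)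
    simp [Ring.lie_def, hρ, hadT.map_lie_apply]
  · refine I.linearMap_qext (LinearMap.ext fun u => ?_)
    simp [Ring.lie_def, hρ, hη, hadT.2.1, hadT.2.2]
  · refine (lift_eq_zero_iff_mem hr hη u).2 (hker u (Submodule.mem_iSup_of_mem r hu) ?_)
    rw [hτt r u hu, h0, TensorProduct.tmul_zero]

end

/-- Let `𝔐` be the set of two-sided `ad_T`-invariant ideals of `T(a)`
containing `ker τ[t]`, and `𝓜` the set of isomorphism classes of `a[t]`-modules.
(a) The map `𝔐 → 𝓜`, `𝕀 ↦ [T(a)/𝕀 = V(ρ_𝕀, η_𝕀)]`, is injective: if the modules attached to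
two such ideals are isomorphic then the ideals coincide.
(b) The map `𝓜 → 𝔐`, `[V(ρ,η)] ↦ 𝕀(ρ,η) = ker η_T`, lands in `𝔐` and is surjective. -/
theorem statement9 (a : Type u) [LieRing a] [LieAlgebra ℂ a]
    (h𝔞 : Submodule.span ℂ {z : a | ∃ x y : a, z = ⁅x, y⁆} = ⊤)
    (τ : TensorAlgebra ℂ a →ₗ[ℂ] a) (hτ : IsTau a τ)
    (τt : TensorAlgebra ℂ a →ₗ[ℂ] Cur a) (hτt : IsTauT a τ τt)
    (adT : a →ₗ[ℂ] Module.End ℂ (TensorAlgebra ℂ a)) (hadT : IsAdT a adT) :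
    -- (a) injectivity of `𝕀 ↦ [V(ρ_𝕀, η_𝕀)]`
    (∀ (I₁ I₂ : Submodule ℂ (TensorAlgebra ℂ a))
      (_ : ∀ (w : TensorAlgebra ℂ a), ∀ u ∈ I₁, w * u ∈ I₁)
      (_ : ∀ (w : TensorAlgebra ℂ a), ∀ u ∈ I₁, u * w ∈ I₁)
      (_ : ∀ (x : a), ∀ u ∈ I₁, adT x u ∈ I₁)
      (_ : ∀ u ∈ FLie a, τt u = 0 → u ∈ I₁)
      (_ : ∀ (w : TensorAlgebra ℂ a), ∀ u ∈ I₂, w * u ∈ I₂)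
      (_ : ∀ (w : TensorAlgebra ℂ a), ∀ u ∈ I₂, u * w ∈ I₂)
      (_ : ∀ (x : a), ∀ u ∈ I₂, adT x u ∈ I₂)
      (_ : ∀ u ∈ FLie a, τt u = 0 → u ∈ I₂)
      (ρ₁ η₁ : a →ₗ[ℂ] Module.End ℂ (TensorAlgebra ℂ a ⧸ I₁))
      (_ : ∀ (x : a) (u : TensorAlgebra ℂ a),
        ρ₁ x (Submodule.Quotient.mk u) = Submodule.Quotient.mk (adT x u))
      (_ : ∀ (x : a) (u : TensorAlgebra ℂ a),
        η₁ x (Submodule.Quotient.mk u) = Submodule.Quotient.mk (TensorAlgebra.ι ℂ x * u))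
      (ρ₂ η₂ : a →ₗ[ℂ] Module.End ℂ (TensorAlgebra ℂ a ⧸ I₂))
      (_ : ∀ (x : a) (u : TensorAlgebra ℂ a),
        ρ₂ x (Submodule.Quotient.mk u) = Submodule.Quotient.mk (adT x u))
      (_ : ∀ (x : a) (u : TensorAlgebra ℂ a),
        η₂ x (Submodule.Quotient.mk u) = Submodule.Quotient.mk (TensorAlgebra.ι ℂ x * u))
      (φ : (TensorAlgebra ℂ a ⧸ I₁) ≃ₗ[ℂ] (TensorAlgebra ℂ a ⧸ I₂))
      (_ : IsCurHom a ρ₁ η₁ ρ₂ η₂ φ.toLinearMap),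
      I₁ = I₂) ∧
    -- (b) the map `[V(ρ,η)] ↦ ker η_T` takes values in `𝔐` ...
    (∀ (V : Type u) (_ : AddCommGroup V) (_ : Module ℂ V)
      (ρ η : a →ₗ[ℂ] Module.End ℂ V), MemH a τ ρ η →
      (∀ (w : TensorAlgebra ℂ a), ∀ u : TensorAlgebra ℂ a,
        (TensorAlgebra.lift ℂ η u : Module.End ℂ V) = 0 →
        (TensorAlgebra.lift ℂ η (w * u) : Module.End ℂ V) = 0 ∧
        (TensorAlgebra.lift ℂ η (u * w) : Module.End ℂ V) = 0) ∧
      (∀ (x : a) (u : TensorAlgebra ℂ a),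
        (TensorAlgebra.lift ℂ η u : Module.End ℂ V) = 0 →
        (TensorAlgebra.lift ℂ η (adT x u) : Module.End ℂ V) = 0) ∧
      (∀ u ∈ FLie a, τt u = 0 → (TensorAlgebra.lift ℂ η u : Module.End ℂ V) = 0)) ∧
    -- ... and is surjective
    (∀ (I : Submodule ℂ (TensorAlgebra ℂ a))
      (_ : ∀ (w : TensorAlgebra ℂ a), ∀ u ∈ I, w * u ∈ I)
      (_ : ∀ (w : TensorAlgebra ℂ a), ∀ u ∈ I, u * w ∈ I)
      (_ : ∀ (x : a), ∀ u ∈ I, adT x u ∈ I)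
      (_ : ∀ u ∈ FLie a, τt u = 0 → u ∈ I),
      ∃ (V : Type u) (_ : AddCommGroup V) (_ : Module ℂ V)
        (ρ η : a →ₗ[ℂ] Module.End ℂ V),
        MemH a τ ρ η ∧
        ∀ w : TensorAlgebra ℂ a,
          ((TensorAlgebra.lift ℂ η w : Module.End ℂ V) = 0 ↔ w ∈ I)) := by
  refine ⟨?_, ?_, ?_⟩
  · intro I₁ I₂ _ hr₁ _ _ _ hr₂ _ _ ρ₁ η₁ _ hη₁ ρ₂ η₂ _ hη₂ φ hφ
    ext w
    rw [← lift_eq_zero_iff_mem hr₁ hη₁ w, ← lift_eq_zero_iff_mem hr₂ hη₂ w]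
    exact hφ.lift_eq_zero_iff w
  · intro V _ _ ρ η h
    refine ⟨fun w u hu => ?_, fun x u hu => ?_, fun u hu h0 =>
      h.lift_eq_zero_of_mem_FLie hτt hu h0⟩
    · rw [map_mul, map_mul, hu, mul_zero, zero_mul]
      exact ⟨rfl, rfl⟩
    · rw [lift_adT_apply hadT h.2.1, hu, Ring.lie_def, mul_zero, zero_mul, sub_zero]
  · intro I hl hr had hker
    obtain ⟨ρ, η, h, hη⟩ := exists_memH_quotient hτt hadT hl hr had hker
    exact ⟨_, _, _, ρ, η, h, lift_eq_zero_iff_mem hr hη⟩
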